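/- arXiv:math/0206044 — 7 statements merged into one kernel-verified Lean document; each statement's English description precedes it below -/
import Mathlib

section
/- Let Q be a symmetric 4×4 matrix over ℂ, let x, y ∈ ℂ⁴ be linearly independent with Plücker vector p ∈ ℂ⁶, and let q(s,t) = (sx+ty)ᵀQ(sx+ty) ∈ ℂ[s,t] be the restriction of the quadratic form of Q to the line spanned by x and y. Then pᵀ(∧²Q)p = 0 if and only if q is singular, i.e. either q is the zero polynomial or there exists (s₀,t₀) ≠ (0,0) in ℂ² such that (t₀s − s₀t)² divides q. (This is the criterion for the line through x and y in ℙ³ to be tangent to the quadric defined by Q.) -/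
open MvPolynomial

/-- The Plücker vector of a pair of points `x, y ∈ ℂ⁴`, with coordinates
`p_{ij} = x_i y_j - x_j y_i` listed in the order `(01, 02, 03, 12, 13, 23)`. -/
def plucker (x y : Fin 4 → ℂ) : Fin 6 → ℂ :=
  ![x 0 * y 1 - x 1 * y 0, x 0 * y 2 - x 2 * y 0, x 0 * y 3 - x 3 * y 0,
    x 1 * y 2 - x 2 * y 1, x 1 * y 3 - x 3 * y 1, x 2 * y 3 - x 3 * y 2]

/-- The six pairs `(i₁ < i₂)` of indices in `{0,1,2,3}`, in the order
`(0,1), (0,2), (0,3), (1,2), (1,3), (2,3)`. -/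
def pairIdx : Fin 6 → Fin 4 × Fin 4 :=
  ![(0,1), (0,2), (0,3), (1,2), (1,3), (2,3)]

/-- The second exterior power `∧²Q` of a 4×4 matrix. -/
def wedge2 (Q : Matrix (Fin 4) (Fin 4) ℂ) : Matrix (Fin 6) (Fin 6) ℂ :=
  Matrix.of fun I J =>
    Q (pairIdx I).1 (pairIdx J).1 * Q (pairIdx I).2 (pairIdx J).2
      - Q (pairIdx I).1 (pairIdx J).2 * Q (pairIdx I).2 (pairIdx J).1

/-- The discriminant criterion for a binary quadratic form `a s² + 2 b s t + c t²`: it vanishes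
iff the form is divisible by the square of a nonzero linear form. -/
theorem disc_eq_zero_iff_exists_sq_dvd (a b c : ℂ) :
    a * c - b ^ 2 = 0 ↔ ∃ s₀ t₀ : ℂ, (s₀, t₀) ≠ (0, 0) ∧
      (C t₀ * X 0 - C s₀ * X 1 : MvPolynomial (Fin 2) ℂ) ^ 2 ∣
        C a * X 0 ^ 2 + 2 * C b * X 0 * X 1 + C c * X 1 ^ 2 := by
  constructor
  · intro h
    by_cases ha : a = 0
    · subst ha
      obtain rfl : b = 0 := by simpa using h
      exact ⟨1, 0, by simp, C c, by simp; ring⟩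
    · refine ⟨-b, a, by simp [ha], C a⁻¹, ?_⟩
      have hb : (C c : MvPolynomial (Fin 2) ℂ) = C b ^ 2 * C a⁻¹ := by
        rw [← C_pow, ← C_mul]
        congr 1
        field_simp
        linear_combination h
      have haa : (C a * C a⁻¹ : MvPolynomial (Fin 2) ℂ) = 1 := by
        rw [← C_mul, mul_inv_cancel₀ ha, C_1]
      rw [hb, C_neg]
      linear_combination (-C a * X 0 ^ 2 - 2 * C b * X 0 * X 1) * haa
  · rintro ⟨s, t, hst, r, hr⟩
    have h0 := congrArg (fun f => eval ![s, t] (pderiv 0 f)) hr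
    have h1 := congrArg (fun f => eval ![s, t] (pderiv 1 f)) hr
    have h2 : pderiv 0 (2 : MvPolynomial (Fin 2) ℂ) = 0 := (pderiv 0).map_natCast 2
    have h3 : pderiv 1 (2 : MvPolynomial (Fin 2) ℂ) = 0 := (pderiv 1).map_natCast 2
    simp [pderiv_X, h2, h3, Derivation.leibniz_pow, mul_comm t s] at h0 h1
    have e0 : a * s + b * t = 0 := by linear_combination h0 / 2
    have e1 : b * s + c * t = 0 := by linear_combination h1 / 2
    by_cases hs : s = 0
    · have ht : t ≠ 0 := fun ht => hst (by rw [hs, ht])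
      apply mul_right_cancel₀ ht
      linear_combination a * e1 - b * e0
    · apply mul_right_cancel₀ hs
      linear_combination c * e0 - b * e1

/-- Cauchy–Binet for `∧²Q`: the value at a Plücker vector is the Gram determinant. -/
theorem sum_plucker_wedge2_plucker (Q : Matrix (Fin 4) (Fin 4) ℂ) (x y : Fin 4 → ℂ) :
    (∑ i, ∑ j, plucker x y i * wedge2 Q i j * plucker x y j) =
      (∑ i, ∑ j, x i * Q i j * x j) * (∑ i, ∑ j, y i * Q i j * y j) -
        (∑ i, ∑ j, x i * Q i j * y j) * (∑ i, ∑ j, y i * Q i j * x j) := by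
  simp only [Fin.sum_univ_six, Fin.sum_univ_four, plucker, wedge2, pairIdx, Matrix.of_apply,
    Matrix.cons_val]
  ring

/-- For a symmetric `Q` and linearly independent `x, y ∈ ℂ⁴` with Plücker vector `p`,
and `q(s,t) = (sx+ty)ᵀQ(sx+ty)` the restriction of the quadratic form of `Q` to the
line spanned by `x` and `y`, one has `pᵀ(∧²Q)p = 0` iff `q` is singular: either `q = 0`
or some square of a nonzero linear form `(t₀ s - s₀ t)²` divides `q`. -/
theorem stmt1 (Q : Matrix (Fin 4) (Fin 4) ℂ) (hQ : Q.IsSymm)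
    (x y : Fin 4 → ℂ) (hxy : LinearIndependent ℂ ![x, y])
    (q : MvPolynomial (Fin 2) ℂ)
    (hq : q = ∑ i, ∑ j,
      (X 0 * C (x i) + X 1 * C (y i)) * C (Q i j) * (X 0 * C (x j) + X 1 * C (y j))) :
    (∑ i, ∑ j, plucker x y i * wedge2 Q i j * plucker x y j) = 0 ↔
      (q = 0 ∨ ∃ s₀ t₀ : ℂ, (s₀, t₀) ≠ (0, 0) ∧
        (C t₀ * X 0 - C s₀ * X 1) ^ 2 ∣ q) := by
  have hyx : (∑ i, ∑ j, y i * Q i j * x j) = ∑ i, ∑ j, x i * Q i j * y j := by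
    rw [Finset.sum_comm]
    refine Finset.sum_congr rfl fun i _ => Finset.sum_congr rfl fun j _ => ?_
    rw [hQ.apply]
    ring
  have hq' : q = C (∑ i, ∑ j, x i * Q i j * x j) * X 0 ^ 2 +
      2 * C (∑ i, ∑ j, x i * Q i j * y j) * X 0 * X 1 +
      C (∑ i, ∑ j, y i * Q i j * y j) * X 1 ^ 2 := by
    rw [two_mul, add_mul]
    nth_rewrite 2 [← hyx]
    simp only [hq, map_sum, C_mul, Finset.sum_mul, add_mul, ← Finset.sum_add_distrib]
    refine Finset.sum_congr rfl fun i _ => Finset.sum_congr rfl fun j _ => ?_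
    ring
  rw [sum_plucker_wedge2_plucker, hyx, ← sq, disc_eq_zero_iff_exists_sq_dvd, ← hq']
  refine ⟨Or.inr, ?_⟩
  rintro (h | h)
  · exact ⟨1, 0, by simp, h ▸ dvd_zero _⟩
  · exact h
end

section
/- Let F ∈ ℂ[w,x,y,z] be bihomogeneous of bidegree (2,2) and smooth. Then F is irreducible in ℂ[w,x,y,z]. -/
/-- A polynomial `F ∈ ℂ[w,x,y,z]` (variables indexed `0,1,2,3` for `w,x,y,z`)
is bihomogeneous of bidegree `(a,b)` if every monomial of `F` has total degree `a`
in `w,x` and total degree `b` in `y,z`. -/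
def IsBihom (a b : ℕ) (F : MvPolynomial (Fin 4) ℂ) : Prop :=
  ∀ m ∈ F.support, m 0 + m 1 = a ∧ m 2 + m 3 = b

/-- A bihomogeneous polynomial of bidegree `(2,2)` is smooth if there is no point
`(w₀,x₀,y₀,z₀)` with `(w₀,x₀) ≠ (0,0)` and `(y₀,z₀) ≠ (0,0)` at which `F` and all
four partial derivatives vanish. -/
def IsSmooth22 (F : MvPolynomial (Fin 4) ℂ) : Prop :=
  ¬ ∃ w₀ x₀ y₀ z₀ : ℂ, (w₀, x₀) ≠ (0, 0) ∧ (y₀, z₀) ≠ (0, 0) ∧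
    MvPolynomial.eval ![w₀, x₀, y₀, z₀] F = 0 ∧
    ∀ i : Fin 4, MvPolynomial.eval ![w₀, x₀, y₀, z₀] (MvPolynomial.pderiv i F) = 0

open MvPolynomial in
/-- The homomorphism `Xᵢ ↦ Xᵢ t ^ (w i)`, recording the `w`-degree of a polynomial as the exponent
of an auxiliary variable `t`. -/
noncomputable def weightHom {σ R : Type*} [CommRing R] (w : σ → ℕ) :
    MvPolynomial σ R →ₐ[R] Polynomial (MvPolynomial σ R) :=
  aeval fun i => Polynomial.monomial (w i) (X i)

open MvPolynomial in
theorem weightHom_monomial {σ R : Type*} [CommRing R] (w : σ → ℕ) (m : σ →₀ ℕ) (r : R) :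
    weightHom w (monomial m r) = Polynomial.monomial (Finsupp.weight w m) (monomial m r) := by
  induction m using Finsupp.induction_linear generalizing r with
  | zero =>
    simp only [map_zero]
    exact (weightHom w).commutes r
  | add f g hf hg =>
    rw [show monomial (f + g) r = monomial f r * monomial g 1 by simp [monomial_mul],
      map_mul, hf, hg, Polynomial.monomial_mul_monomial, map_add]
  | single i n =>
    rw [show monomial (Finsupp.single i n) r = C r * X i ^ n by
      rw [C_mul_X_pow_eq_monomial]]
    have hC : weightHom w (C r) = Polynomial.C (C r) := (weightHom w).commutes r
    have hX : weightHom w (X i : MvPolynomial σ R) = Polynomial.monomial (w i) (X i) :=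
      aeval_X _ _
    rw [map_mul, map_pow, hC, hX, Polynomial.monomial_pow, Polynomial.C_mul_monomial,
      Finsupp.weight_single, smul_eq_mul, mul_comm]

open MvPolynomial in
theorem coeff_coeff_weightHom {σ R : Type*} [CommRing R] (w : σ → ℕ) (p : MvPolynomial σ R)
    (k : ℕ) (m : σ →₀ ℕ) :
    coeff m ((weightHom w p).coeff k) = if Finsupp.weight w m = k then coeff m p else 0 := by
  classical
  induction p using MvPolynomial.induction_on' with
  | monomial u a =>
    rw [weightHom_monomial, Polynomial.coeff_monomial]
    by_cases h : u = m
    · subst h; split_ifs <;> simp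
    · split_ifs <;> simp [coeff_monomial, h]
  | add p q hp hq =>
    rw [map_add, Polynomial.coeff_add, coeff_add, hp, hq]
    split_ifs <;> simp

open MvPolynomial in
/-- Factors of a nonzero weighted homogeneous polynomial over a domain are weighted homogeneous. -/
theorem MvPolynomial.IsWeightedHomogeneous.exists_of_mul {σ R : Type*} [CommRing R] [IsDomain R]
    {w : σ → ℕ} {p q : MvPolynomial σ R} {n : ℕ} (h : IsWeightedHomogeneous w (p * q) n)
    (hpq : p * q ≠ 0) :
    ∃ a b, IsWeightedHomogeneous w p a ∧ IsWeightedHomogeneous w q b ∧ a + b = n := by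
  have hinj : ∀ r : MvPolynomial σ R, weightHom w r = 0 → r = 0 := fun r hr => by
    ext m
    simpa [hr] using (coeff_coeff_weightHom w r (Finsupp.weight w m) m).symm
  have hp : weightHom w p ≠ 0 := fun h0 => left_ne_zero_of_mul hpq (hinj p h0)
  have hq : weightHom w q ≠ 0 := fun h0 => right_ne_zero_of_mul hpq (hinj q h0)
  have hmon : weightHom w (p * q) = Polynomial.monomial n (p * q) := by
    ext k m
    rw [coeff_coeff_weightHom, Polynomial.coeff_monomial]
    by_cases hm : coeff m (p * q) = 0
    · split_ifs <;> simp [hm]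
    · rw [h hm]
      split_ifs <;> simp
  have hdeg : (weightHom w p).natDegree + (weightHom w q).natDegree = n := by
    rw [← Polynomial.natDegree_mul hp hq, ← map_mul, hmon, Polynomial.natDegree_monomial_eq _ hpq]
  have htr : (weightHom w p).natTrailingDegree + (weightHom w q).natTrailingDegree = n := by
    rw [← Polynomial.natTrailingDegree_mul hp hq, ← map_mul, hmon,
      Polynomial.natTrailingDegree_monomial hpq]
  have hp' := Polynomial.natTrailingDegree_le_natDegree (weightHom w p)
  have hq' := Polynomial.natTrailingDegree_le_natDegree (weightHom w q)
  have key : ∀ r : MvPolynomial σ R,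
      (weightHom w r).natTrailingDegree = (weightHom w r).natDegree →
      IsWeightedHomogeneous w r (weightHom w r).natDegree := by
    intro r hr m hm
    have hne : (weightHom w r).coeff (Finsupp.weight w m) ≠ 0 := fun h0 => hm <| by
      simpa [h0] using (coeff_coeff_weightHom w r (Finsupp.weight w m) m).symm
    exact le_antisymm (Polynomial.le_natDegree_of_ne_zero hne)
      (hr ▸ Polynomial.natTrailingDegree_le_of_ne_zero hne)
  exact ⟨_, _, key p (by omega), key q (by omega), hdeg⟩

theorem isBihom_iff_isWeightedHomogeneous {a b : ℕ} {F : MvPolynomial (Fin 4) ℂ} :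
    IsBihom a b F ↔ F.IsWeightedHomogeneous ![1, 1, 0, 0] a ∧
      F.IsWeightedHomogeneous ![0, 0, 1, 1] b := by
  simp only [IsBihom, MvPolynomial.IsWeightedHomogeneous, Finsupp.weight_eq_sum,
    Fin.sum_univ_four, MvPolynomial.mem_support_iff]
  simp
  grind

theorem IsBihom.exists_of_mul {n k : ℕ} {G H : MvPolynomial (Fin 4) ℂ}
    (h : IsBihom n k (G * H)) (h0 : G * H ≠ 0) :
    ∃ a b c d, IsBihom a b G ∧ IsBihom c d H ∧ a + c = n ∧ b + d = k := by
  obtain ⟨h1, h2⟩ := isBihom_iff_isWeightedHomogeneous.1 h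
  obtain ⟨a, c, ha, hc, hac⟩ := h1.exists_of_mul h0
  obtain ⟨b, d, hb, hd, hbd⟩ := h2.exists_of_mul h0
  exact ⟨a, b, c, d, isBihom_iff_isWeightedHomogeneous.2 ⟨ha, hb⟩,
    isBihom_iff_isWeightedHomogeneous.2 ⟨hc, hd⟩, hac, hbd⟩

theorem IsBihom.eval_smul {a b : ℕ} {G : MvPolynomial (Fin 4) ℂ} (h : IsBihom a b G)
    (s t w x y z : ℂ) :
    MvPolynomial.eval ![s * w, s * x, t * y, t * z] G =
      s ^ a * t ^ b * MvPolynomial.eval ![w, x, y, z] G := by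
  rw [MvPolynomial.eval_eq', MvPolynomial.eval_eq', Finset.mul_sum]
  refine Finset.sum_congr rfl fun m hm => ?_
  obtain ⟨rfl, rfl⟩ := h m hm
  simp [Fin.prod_univ_four]
  ring

/-- A form of degree one in `w, x` is linear in `(w, x)`. -/
theorem IsBihom.eval_linear {b : ℕ} {G : MvPolynomial (Fin 4) ℂ} (h : IsBihom 1 b G)
    (w x y z : ℂ) :
    MvPolynomial.eval ![w, x, y, z] G =
      w * MvPolynomial.eval ![1, 0, y, z] G + x * MvPolynomial.eval ![0, 1, y, z] G := by
  simp only [MvPolynomial.eval_eq', Finset.mul_sum, ← Finset.sum_add_distrib]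
  refine Finset.sum_congr rfl fun m hm => ?_
  have h1 := (h m hm).1
  have : (m 0 = 0 ∧ m 1 = 1) ∨ (m 0 = 1 ∧ m 1 = 0) := by omega
  rcases this with ⟨h0, h1⟩ | ⟨h0, h1⟩ <;> simp [Fin.prod_univ_four, h0, h1] <;> ring

theorem IsBihom.isUnit {G : MvPolynomial (Fin 4) ℂ} (h : IsBihom 0 0 G) (h0 : G ≠ 0) :
    IsUnit G := by
  have hG : G = MvPolynomial.C (MvPolynomial.coeff 0 G) := by
    ext m
    rw [MvPolynomial.coeff_C]
    split_ifs with hm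
    · rw [hm]
    · by_contra hne
      have := h m (MvPolynomial.mem_support_iff.2 hne)
      refine hm (Finsupp.ext fun i => ?_)
      fin_cases i <;> simp <;> omega
  rw [hG]
  refine (isUnit_iff_ne_zero.2 fun hc => h0 ?_).map MvPolynomial.C
  rw [hG, hc, map_zero]

/-- A binary form of positive degree over `ℂ` has a nontrivial zero. -/
theorem exists_zero_of_binary_form {d : ℕ} (hd : d ≠ 0) (Q : MvPolynomial (Fin 2) ℂ)
    (hQ : ∀ t u v : ℂ, MvPolynomial.eval ![t * u, t * v] Q = t ^ d * MvPolynomial.eval ![u, v] Q) :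
    ∃ u v : ℂ, (u, v) ≠ (0, 0) ∧ MvPolynomial.eval ![u, v] Q = 0 := by
  have heval : ∀ (f : Fin 2 → Polynomial ℂ) (t : ℂ), (MvPolynomial.aeval f Q).eval t =
      MvPolynomial.eval ![(f 0).eval t, (f 1).eval t] Q := by
    intro f t
    rw [MvPolynomial.aeval_def, MvPolynomial.eval₂_eq', MvPolynomial.eval_eq']
    simp [Polynomial.eval_finsetSum]
  by_cases hdeg : (MvPolynomial.aeval ![Polynomial.X, 1] Q : Polynomial ℂ).degree = 0
  · obtain ⟨c, hc⟩ : ∃ c, MvPolynomial.aeval ![Polynomial.X, 1] Q = Polynomial.C c :=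
      ⟨_, Polynomial.eq_C_of_degree_eq_zero hdeg⟩
    have hq : MvPolynomial.aeval ![1, Polynomial.X] Q = Polynomial.C c * Polynomial.X ^ d := by
      refine Polynomial.eq_of_infinite_eval_eq _ _
        (Set.Infinite.mono (s := {0}ᶜ) ?_ (Set.finite_singleton 0).infinite_compl)
      intro t ht
      have ht : t ≠ 0 := ht
      have h1 := heval ![Polynomial.X, 1] t⁻¹
      have h2 := hQ t t⁻¹ 1
      simp only [Set.mem_ofPred_eq, heval]
      simp [hc, ht] at h1 h2 ⊢
      rw [h2, ← h1, mul_comm]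
    refine ⟨1, 0, by simp, ?_⟩
    have h := heval ![1, Polynomial.X] 0
    rw [hq] at h
    simpa [hd] using h.symm
  · obtain ⟨t, ht⟩ := IsAlgClosed.exists_root _ hdeg
    refine ⟨t, 1, by simp, ?_⟩
    rw [Polynomial.IsRoot, heval] at ht
    simpa using ht

/-- Evaluation commutes with substituting binary forms for the four variables. -/
theorem eval_aeval_binary (f : Fin 4 → MvPolynomial (Fin 2) ℂ) (p : Fin 2 → ℂ)
    (G : MvPolynomial (Fin 4) ℂ) :
    MvPolynomial.eval p (MvPolynomial.aeval f G) =
      MvPolynomial.eval ![MvPolynomial.eval p (f 0), MvPolynomial.eval p (f 1),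
        MvPolynomial.eval p (f 2), MvPolynomial.eval p (f 3)] G := by
  rw [MvPolynomial.aeval_def, MvPolynomial.eval₂_eq', MvPolynomial.eval_eq' _ G]
  simp [Fin.prod_univ_four]

theorem IsBihom.exists_zero_right {a b : ℕ} {G : MvPolynomial (Fin 4) ℂ} (h : IsBihom a b G)
    (hb : b ≠ 0) (w x : ℂ) :
    ∃ y z : ℂ, (y, z) ≠ (0, 0) ∧ MvPolynomial.eval ![w, x, y, z] G = 0 := by
  have he : ∀ y z : ℂ, MvPolynomial.eval ![y, z] (MvPolynomial.aeval
      ![MvPolynomial.C w, MvPolynomial.C x, MvPolynomial.X 0, MvPolynomial.X 1] G) =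
      MvPolynomial.eval ![w, x, y, z] G := fun y z => by
    rw [eval_aeval_binary]; simp
  obtain ⟨y, z, hne, hyz⟩ := exists_zero_of_binary_form hb _ fun t u v => by
    rw [he, he]
    simpa using h.eval_smul 1 t w x u v
  exact ⟨y, z, hne, by rwa [he] at hyz⟩

theorem IsBihom.exists_zero_left {a b : ℕ} {G : MvPolynomial (Fin 4) ℂ} (h : IsBihom a b G)
    (ha : a ≠ 0) (y z : ℂ) :
    ∃ w x : ℂ, (w, x) ≠ (0, 0) ∧ MvPolynomial.eval ![w, x, y, z] G = 0 := by
  have he : ∀ w x : ℂ, MvPolynomial.eval ![w, x] (MvPolynomial.aeval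
      ![MvPolynomial.X 0, MvPolynomial.X 1, MvPolynomial.C y, MvPolynomial.C z] G) =
      MvPolynomial.eval ![w, x, y, z] G := fun w x => by
    rw [eval_aeval_binary]; simp
  obtain ⟨w, x, hne, hwx⟩ := exists_zero_of_binary_form ha _ fun t u v => by
    rw [he, he]
    simpa using h.eval_smul t 1 u v y z
  exact ⟨w, x, hne, by rwa [he] at hwx⟩

/-- The common zero locus of `G` and `H` in `ℙ¹ × ℙ¹` is nonempty. -/
def HasCommonZero (G H : MvPolynomial (Fin 4) ℂ) : Prop :=
  ∃ w x y z : ℂ, (w, x) ≠ (0, 0) ∧ (y, z) ≠ (0, 0) ∧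
    MvPolynomial.eval ![w, x, y, z] G = 0 ∧ MvPolynomial.eval ![w, x, y, z] H = 0

theorem HasCommonZero.symm {G H : MvPolynomial (Fin 4) ℂ} (h : HasCommonZero G H) :
    HasCommonZero H G := by
  obtain ⟨w, x, y, z, h1, h2, hG, hH⟩ := h
  exact ⟨w, x, y, z, h1, h2, hH, hG⟩

theorem IsBihom.hasCommonZero_of_left {a c d : ℕ} {G H : MvPolynomial (Fin 4) ℂ}
    (hG : IsBihom a 0 G) (hH : IsBihom c d H) (ha : a ≠ 0) (hd : d ≠ 0) : HasCommonZero G H := by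
  obtain ⟨w, x, hwx, h0⟩ := hG.exists_zero_left ha 0 0
  obtain ⟨y, z, hyz, h1⟩ := hH.exists_zero_right hd w x
  refine ⟨w, x, y, z, hwx, hyz, ?_, h1⟩
  have := hG.eval_smul 1 0 w x y z
  simp at this
  rw [← this, h0]

theorem IsBihom.hasCommonZero_of_right {b c d : ℕ} {G H : MvPolynomial (Fin 4) ℂ}
    (hG : IsBihom 0 b G) (hH : IsBihom c d H) (hb : b ≠ 0) (hc : c ≠ 0) : HasCommonZero G H := by
  obtain ⟨y, z, hyz, h0⟩ := hG.exists_zero_right hb 0 0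
  obtain ⟨w, x, hwx, h1⟩ := hH.exists_zero_left hc y z
  refine ⟨w, x, y, z, hwx, hyz, ?_, h1⟩
  have := hG.eval_smul 0 1 w x y z
  simp at this
  rw [← this, h0]

theorem exists_ne_zero_of_det_eq_zero {A B C D : ℂ} (h : A * D - B * C = 0) :
    ∃ w x : ℂ, (w, x) ≠ (0, 0) ∧ w * A + x * B = 0 ∧ w * C + x * D = 0 := by
  by_cases h1 : A = 0 ∧ B = 0
  · by_cases h2 : C = 0 ∧ D = 0
    · exact ⟨1, 0, by simp, by simp [h1.1], by simp [h2.1]⟩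
    · refine ⟨D, -C, ?_, by simp [h1.1, h1.2], by ring⟩
      simp only [ne_eq, Prod.mk.injEq, neg_eq_zero]
      tauto
  · refine ⟨B, -A, ?_, by ring, by linear_combination -h⟩
    simp only [ne_eq, Prod.mk.injEq, neg_eq_zero]
    tauto

/-- Two forms that are linear in `w, x` have a common zero where their determinant, a form in
`y, z`, vanishes. -/
theorem IsBihom.hasCommonZero_of_linear {b d : ℕ} {G H : MvPolynomial (Fin 4) ℂ}
    (hG : IsBihom 1 b G) (hH : IsBihom 1 d H) (hbd : b + d ≠ 0) : HasCommonZero G H := by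
  have he : ∀ (r s y z : ℂ) (P : MvPolynomial (Fin 4) ℂ), MvPolynomial.eval ![y, z]
      (MvPolynomial.aeval
        ![MvPolynomial.C r, MvPolynomial.C s, MvPolynomial.X 0, MvPolynomial.X 1] P) =
      MvPolynomial.eval ![r, s, y, z] P := fun r s y z P => by
    rw [eval_aeval_binary]; simp
  let φ (r s : ℂ) : MvPolynomial (Fin 4) ℂ →ₐ[ℂ] MvPolynomial (Fin 2) ℂ :=
    MvPolynomial.aeval ![MvPolynomial.C r, MvPolynomial.C s, MvPolynomial.X 0, MvPolynomial.X 1]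
  obtain ⟨y, z, hyz, hdet⟩ := exists_zero_of_binary_form hbd
    (φ 1 0 G * φ 0 1 H - φ 0 1 G * φ 1 0 H) fun t u v => by
      have hs : ∀ {k : ℕ} {P : MvPolynomial (Fin 4) ℂ}, IsBihom 1 k P → ∀ r s : ℂ,
          MvPolynomial.eval ![r, s, t * u, t * v] P =
            t ^ k * MvPolynomial.eval ![r, s, u, v] P := fun hP r s => by
        simpa using hP.eval_smul 1 t r s u v
      simp only [φ, map_sub, map_mul, he, hs hG, hs hH]
      ring
  simp only [φ, map_sub, map_mul, he] at hdet
  obtain ⟨w, x, hwx, h1, h2⟩ := exists_ne_zero_of_det_eq_zero hdet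
  exact ⟨w, x, y, z, hwx, hyz, by rw [hG.eval_linear, h1], by rw [hH.eval_linear, h2]⟩

theorem IsSmooth22.not_hasCommonZero {G H : MvPolynomial (Fin 4) ℂ} (h : IsSmooth22 (G * H)) :
    ¬ HasCommonZero G H := by
  rintro ⟨w, x, y, z, hwx, hyz, hG, hH⟩
  refine h ⟨w, x, y, z, hwx, hyz, by simp [hG], fun i => ?_⟩
  simp [hG, hH, Derivation.leibniz]

/-- A smooth bihomogeneous polynomial of bidegree `(2,2)` is irreducible. -/
theorem stmt3 (F : MvPolynomial (Fin 4) ℂ) (hFb : IsBihom 2 2 F) (hsm : IsSmooth22 F) :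
    Irreducible F := by
  have hF0 : F ≠ 0 := by
    rintro rfl
    exact hsm ⟨1, 0, 1, 0, by simp, by simp, by simp, by simp⟩
  refine ⟨fun hu => ?_, fun G H hGH => ?_⟩
  · obtain ⟨r, hr, rfl⟩ := MvPolynomial.isUnit_iff_eq_C_of_isReduced.1 hu
    have := hFb 0 (by simpa using hr.ne_zero)
    simp at this
  · subst hGH
    obtain ⟨a, b, c, d, hG, hH, hac, hbd⟩ := hFb.exists_of_mul hF0
    by_contra! hu
    have hG0 : ¬ (a = 0 ∧ b = 0) := by
      rintro ⟨rfl, rfl⟩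
      exact hu.1 (hG.isUnit (left_ne_zero_of_mul hF0))
    have hH0 : ¬ (c = 0 ∧ d = 0) := by
      rintro ⟨rfl, rfl⟩
      exact hu.2 (hH.isUnit (right_ne_zero_of_mul hF0))
    apply hsm.not_hasCommonZero
    rcases Nat.eq_zero_or_pos b with rfl | hb
    · exact hG.hasCommonZero_of_left hH (by omega) (by omega)
    rcases Nat.eq_zero_or_pos d with rfl | hd
    · exact (hH.hasCommonZero_of_left hG (by omega) (by omega)).symm
    rcases Nat.eq_zero_or_pos a with rfl | ha
    · exact hG.hasCommonZero_of_right hH (by omega) (by omega)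
    rcases Nat.eq_zero_or_pos c with rfl | hc
    · exact (hH.hasCommonZero_of_right hG (by omega) (by omega)).symm
    obtain rfl : a = 1 := by omega
    obtain rfl : c = 1 := by omega
    exact hG.hasCommonZero_of_linear hH (by omega)
end

section
/- Let a,b,c,d be natural numbers with ad ≠ 0 or bc ≠ 0, let F ∈ ℂ[w,x,y,z] be nonzero and bihomogeneous of bidegree (a,b), and let G ∈ ℂ[w,x,y,z] be nonzero and bihomogeneous of bidegree (c,d). Then there exists (w₀,x₀,y₀,z₀) ∈ ℂ⁴ with (w₀,x₀) ≠ (0,0) and (y₀,z₀) ≠ (0,0) such that F(w₀,x₀,y₀,z₀) = 0 and G(w₀,x₀,y₀,z₀) = 0. (An (a,b)-curve and a (c,d)-curve on ℙ¹×ℙ¹ meet whenever ad ≠ 0 or bc ≠ 0.) -/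
open Polynomial in
/-- The polynomial `F(X, 1, y, z)` over a `ℂ`-algebra containing `y` and `z`. -/
noncomputable def slice {A : Type*} [CommRing A] [Algebra ℂ A]
    (F : MvPolynomial (Fin 4) ℂ) (y z : A) : A[X] :=
  ∑ m ∈ F.support, C (algebraMap ℂ A (F.coeff m) * (y ^ m 2 * z ^ m 3)) * X ^ m 0

section Slice

open Polynomial

variable {A B : Type*} [CommRing A] [Algebra ℂ A] [CommRing B] [Algebra ℂ B]

theorem map_slice (φ : A →ₐ[ℂ] B) (F : MvPolynomial (Fin 4) ℂ) (y z : A) :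
    (slice F y z).map (φ : A →+* B) = slice F (φ y) (φ z) := by
  simp [slice, Polynomial.map_sum]

theorem natDegree_slice_le {a b : ℕ} {F : MvPolynomial (Fin 4) ℂ} (hF : IsBihom a b F)
    (y z : A) : (slice F y z).natDegree ≤ a := by
  refine natDegree_sum_le_of_forall_le _ _ fun m hm ↦ (natDegree_C_mul_X_pow_le _ _).trans ?_
  have := (hF m hm).1
  omega

theorem slice_mul {a b : ℕ} {F : MvPolynomial (Fin 4) ℂ} (hF : IsBihom a b F) (t y z : A) :
    slice F (t * y) (t * z) = C (t ^ b) * slice F y z := by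
  rw [slice, slice, Finset.mul_sum]
  refine Finset.sum_congr rfl fun m hm ↦ ?_
  rw [← (hF m hm).2]
  simp only [C_mul, C_pow]
  ring

theorem eval_slice (F : MvPolynomial (Fin 4) ℂ) (w y z : ℂ) :
    (slice F y z).eval w = MvPolynomial.eval ![w, 1, y, z] F := by
  rw [slice, eval_finsetSum, MvPolynomial.eval_eq']
  refine Finset.sum_congr rfl fun m _ ↦ ?_
  simp [Fin.prod_univ_four]
  ring

theorem coeff_slice {a b : ℕ} {F : MvPolynomial (Fin 4) ℂ} (hF : IsBihom a b F) (y z : ℂ) :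
    (slice F y z).coeff a = MvPolynomial.eval ![1, 0, y, z] F := by
  rw [slice, finsetSum_coeff, MvPolynomial.eval_eq']
  refine Finset.sum_congr rfl fun m hm ↦ ?_
  have h := (hF m hm).1
  rw [coeff_C_mul_X_pow]
  by_cases h1 : m 1 = 0
  · have h0 : a = m 0 := by omega
    simp [Fin.prod_univ_four, h1, h0]
  · have h0 : a ≠ m 0 := by omega
    simp [Fin.prod_univ_four, h1, h0]

theorem map_resultant_slice (φ : A →ₐ[ℂ] B) (F G : MvPolynomial (Fin 4) ℂ) (y z : A) (a c : ℕ) :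
    φ (resultant (slice F y z) (slice G y z) a c) =
      resultant (slice F (φ y) (φ z)) (slice G (φ y) (φ z)) a c := by
  rw [← map_slice, ← map_slice, resultant_map_map]
  rfl

theorem resultant_slice_mul {a b c d : ℕ} {F G : MvPolynomial (Fin 4) ℂ} (hF : IsBihom a b F)
    (hG : IsBihom c d G) (t y z : A) :
    resultant (slice F (t * y) (t * z)) (slice G (t * y) (t * z)) a c =
      t ^ (b * c + d * a) * resultant (slice F y z) (slice G y z) a c := by
  rw [slice_mul hF, slice_mul hG, resultant_C_mul_left, resultant_C_mul_right]
  ring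

/-- The resultant of two binary forms over an algebraically closed field vanishes only if they
have a common zero, possibly the point at infinity. -/
theorem exists_common_root_of_resultant_eq_zero {K : Type*} [Field K] [IsAlgClosed K] {f g : K[X]}
    {m n : ℕ} (hf : f.natDegree ≤ m) (hg : g.natDegree ≤ n) (h : resultant f g m n = 0) :
    (∃ w, f.eval w = 0 ∧ g.eval w = 0) ∨ (f.coeff m = 0 ∧ g.coeff n = 0) := by
  by_contra! hcon
  obtain ⟨hroot, hinf⟩ := hcon
  have hcop : IsCoprime f g := by
    rw [isCoprime_iff_aeval_ne_zero_of_isAlgClosed K K]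
    intro w
    simp only [coe_aeval_eq_eval]
    by_cases hw : f.eval w = 0
    · exact .inr (hroot w hw)
    · exact .inl hw
  have hres : resultant f g ≠ 0 := resultant_ne_zero f g hcop
  by_cases hm : f.coeff m = 0
  · have hn := hinf hm
    have hgn : n = g.natDegree := le_antisymm (le_natDegree_of_ne_zero hn) hg
    subst hgn
    obtain ⟨k, rfl⟩ := Nat.exists_eq_add_of_le hf
    rw [resultant_add_left_deg _ _ _ _ _ le_rfl] at h
    simp_all
  · have hfm : m = f.natDegree := le_antisymm (le_natDegree_of_ne_zero hm) hf
    subst hfm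
    obtain ⟨k, rfl⟩ := Nat.exists_eq_add_of_le hg
    rw [resultant_add_right_deg _ _ _ _ _ le_rfl] at h
    simp_all

/-- A function on `ℂ²` that is homogeneous of positive degree and polynomial on the two standard
affine lines has a nontrivial zero. -/
theorem exists_zero_of_homogeneous {R : ℂ → ℂ → ℂ} {N : ℕ} (hN : N ≠ 0)
    (hR : ∀ t y z, R (t * y) (t * z) = t ^ N * R y z) {p q : ℂ[X]}
    (hp : ∀ t, p.eval t = R t 1) (hq : ∀ t, q.eval t = R 1 t) :
    ∃ y z : ℂ, (y, z) ≠ (0, 0) ∧ R y z = 0 := by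
  by_cases hroot : ∃ t, p.eval t = 0
  · obtain ⟨t, ht⟩ := hroot
    exact ⟨t, 1, by simp, by rw [← hp, ht]⟩
  have hdeg : p.degree = 0 := by
    by_contra hd
    exact hroot (IsAlgClosed.exists_root p hd)
  obtain ⟨e, he⟩ : ∃ e, p = C e := ⟨_, eq_C_of_degree_eq_zero hdeg⟩
  have hqe : q = C e * X ^ N := by
    refine eq_of_infinite_eval_eq _ _ ((Set.finite_singleton (0 : ℂ)).infinite_compl.mono ?_)
    intro s hs
    have hs : s ≠ 0 := hs
    have hscale := hR s s⁻¹ 1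
    rw [mul_inv_cancel₀ hs, mul_one, ← hp, ← hq, he] at hscale
    simp only [Set.mem_ofPred_eq, hscale, eval_mul, eval_C, eval_pow, eval_X, mul_comm]
  exact ⟨1, 0, by simp, by rw [← hq, hqe]; simp [hN]⟩

end Slice

/-- An `(a,b)`-curve and a `(c,d)`-curve on `ℙ¹ × ℙ¹` meet whenever `ad ≠ 0` or
`bc ≠ 0`: two nonzero bihomogeneous polynomials of such bidegrees have a common
zero `(w₀,x₀,y₀,z₀)` with `(w₀,x₀) ≠ (0,0)` and `(y₀,z₀) ≠ (0,0)`. -/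
theorem stmt4 (a b c d : ℕ) (h : a * d ≠ 0 ∨ b * c ≠ 0)
    (F G : MvPolynomial (Fin 4) ℂ)
    (hF : F ≠ 0) (hFb : IsBihom a b F)
    (hG : G ≠ 0) (hGb : IsBihom c d G) :
    ∃ w₀ x₀ y₀ z₀ : ℂ, (w₀, x₀) ≠ (0, 0) ∧ (y₀, z₀) ≠ (0, 0) ∧
      MvPolynomial.eval ![w₀, x₀, y₀, z₀] F = 0 ∧
      MvPolynomial.eval ![w₀, x₀, y₀, z₀] G = 0 := by
  have hN : b * c + d * a ≠ 0 := by
    rcases h with h | h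
    · rw [mul_comm d a]; omega
    · omega
  obtain ⟨y, z, hyz, hres⟩ := exists_zero_of_homogeneous
    (R := fun y z ↦ Polynomial.resultant (slice F y z) (slice G y z) a c) hN
    (resultant_slice_mul hFb hGb)
    (p := Polynomial.resultant (slice F Polynomial.X 1) (slice G Polynomial.X 1) a c)
    (q := Polynomial.resultant (slice F 1 Polynomial.X) (slice G 1 Polynomial.X) a c)
    (fun t ↦ (map_resultant_slice (Polynomial.aeval t) F G Polynomial.X 1 a c).trans
      (by rw [Polynomial.aeval_X, map_one]))
    (fun t ↦ (map_resultant_slice (Polynomial.aeval t) F G 1 Polynomial.X a c).trans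
      (by rw [Polynomial.aeval_X, map_one]))
  rcases exists_common_root_of_resultant_eq_zero (natDegree_slice_le hFb y z)
    (natDegree_slice_le hGb y z) hres with ⟨w, hw, hw'⟩ | ⟨hw, hw'⟩
  · rw [eval_slice] at hw hw'
    exact ⟨w, 1, y, z, by simp, hyz, hw, hw'⟩
  · rw [coeff_slice hFb] at hw
    rw [coeff_slice hGb] at hw'
    exact ⟨1, 0, y, z, by simp, hyz, hw, hw'⟩
end

section
/- Let F ∈ ℂ[w,x,y,z] be bihomogeneous of bidegree (2,2) and smooth, and write F = α y² + β yz + γ z² with α, β, γ ∈ ℂ[w,x] homogeneous of degree 2. Then the discriminant Δ := β² − 4αγ is nonzero and squarefree: there exist a constant c ≠ 0 and four linear forms L₁, L₂, L₃, L₄ ∈ ℂ[w,x], pairwise non-proportional, with Δ = c·L₁L₂L₃L₄. (Equivalently, the projection of the smooth (2,2)-curve F = 0 to the first ℙ¹ has four distinct ramification points.) -/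
/-- A form of degree `d` in the variables `w,x` alone. -/
def IsFormWX (d : ℕ) (α : MvPolynomial (Fin 4) ℂ) : Prop :=
  ∀ m ∈ α.support, m 0 + m 1 = d ∧ m 2 = 0 ∧ m 3 = 0

open MvPolynomial

/-- A binary form over an algebraically closed field is a product of linear forms, stated for the
homogenization of a univariate polynomial. -/
theorem exists_homogenize_eq_prod_linear {K : Type*} [Field K] [IsAlgClosed K] (n : ℕ)
    (f : Polynomial K) (hf : f.natDegree ≤ n) :
    ∃ (c : K) (p q : Fin n → K),
      f.homogenize n = C c * ∏ i, (C (p i) * X 0 + C (q i) * X 1) := by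
  induction n generalizing f with
  | zero =>
    rw [Polynomial.eq_C_of_natDegree_le_zero hf]
    exact ⟨f.coeff 0, 0, 0, by simp⟩
  | succ n ih =>
    obtain ⟨g, l, p₀, q₀, hg, hl, rfl, hlin⟩ : ∃ (g l : Polynomial K) (p₀ q₀ : K),
        g.natDegree ≤ n ∧ l.natDegree ≤ 1 ∧ g * l = f ∧
          l.homogenize 1 = C p₀ * X 0 + C q₀ * X 1 := by
      rcases hf.lt_or_eq with hlt | heq
      · exact ⟨f, 1, 0, 1, by lia, by simp, by simp, by simp⟩
      · have hdeg : f.degree ≠ 0 := fun h ↦ by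
          have h0 : f.natDegree = 0 := Polynomial.natDegree_eq_of_degree_eq_some h
          lia
        obtain ⟨r, hr⟩ := IsAlgClosed.exists_root f hdeg
        refine ⟨f /ₘ (Polynomial.X - Polynomial.C r), Polynomial.X - Polynomial.C r, 1, -r,
          ?_, Polynomial.natDegree_X_sub_C_le r, ?_, ?_⟩
        · rw [Polynomial.natDegree_divByMonic _ (Polynomial.monic_X_sub_C r),
            Polynomial.natDegree_X_sub_C]
          lia
        · rw [mul_comm, Polynomial.mul_divByMonic_eq_iff_isRoot.mpr hr]
        · simp [sub_eq_add_neg]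
    obtain ⟨c, p, q, hprod⟩ := ih g hg
    refine ⟨c, Fin.snoc p p₀, Fin.snoc q q₀, ?_⟩
    rw [Polynomial.homogenize_mul g l hg hl, hprod, hlin, Fin.prod_univ_castSucc]
    simp [mul_assoc]

/-- A binary quadratic form over `ℂ` has a nontrivial zero. -/
theorem exists_binary_quadratic_zero (a b c : ℂ) :
    ∃ y z : ℂ, (y, z) ≠ (0, 0) ∧ a * y ^ 2 + b * y * z + c * z ^ 2 = 0 := by
  by_cases ha : a = 0
  · exact ⟨1, 0, by simp, by simp [ha]⟩
  · obtain ⟨s, hs⟩ := IsAlgClosed.exists_pow_nat_eq (b ^ 2 - 4 * a * c) (n := 2) (by norm_num)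
    refine ⟨-b + s, 2 * a, by simp [ha], ?_⟩
    linear_combination a * hs

/-- Consider a pencil `A y² + B y z + C z²` of binary quadratic forms with coefficients quadratic
forms in `w, x`, of values `A, B, C` and partial derivatives `A₀, A₁, …` at `(w, x)`. If the
discriminant is singular at `(w, x)`, the total form has a singular point above `(w, x)`. -/
theorem exists_singular_of_discrim_singular {w x A B C A₀ A₁ B₀ B₁ C₀ C₁ : ℂ}
    (hwx : (w, x) ≠ (0, 0))
    (eulerA : w * A₀ + x * A₁ = 2 * A) (eulerB : w * B₀ + x * B₁ = 2 * B)
    (eulerC : w * C₀ + x * C₁ = 2 * C)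
    (h : B ^ 2 - 4 * A * C = 0)
    (h₀ : 2 * B * B₀ - 4 * (A₀ * C + A * C₀) = 0)
    (h₁ : 2 * B * B₁ - 4 * (A₁ * C + A * C₁) = 0) :
    ∃ y z : ℂ, (y, z) ≠ (0, 0) ∧ A * y ^ 2 + B * y * z + C * z ^ 2 = 0 ∧
      A₀ * y ^ 2 + B₀ * y * z + C₀ * z ^ 2 = 0 ∧ A₁ * y ^ 2 + B₁ * y * z + C₁ * z ^ 2 = 0 ∧
      2 * A * y + B * z = 0 ∧ B * y + 2 * C * z = 0 := by
  by_cases hA : A = 0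
  · by_cases hC : C = 0
    · have hB : B = 0 := by simpa [hA] using h
      subst hA hB hC
      by_cases hw : w = 0
      · have hx : x ≠ 0 := fun hx ↦ hwx (by rw [hw, hx])
        obtain ⟨y, z, hyz, hq⟩ := exists_binary_quadratic_zero A₀ B₀ C₀
        refine ⟨y, z, hyz, by ring, hq, mul_left_cancel₀ hx ?_, by ring, by ring⟩
        linear_combination y ^ 2 * eulerA + y * z * eulerB + z ^ 2 * eulerC - w * hq
      · obtain ⟨y, z, hyz, hq⟩ := exists_binary_quadratic_zero A₁ B₁ C₁
        refine ⟨y, z, hyz, by ring, mul_left_cancel₀ hw ?_, hq, by ring, by ring⟩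
        linear_combination y ^ 2 * eulerA + y * z * eulerB + z ^ 2 * eulerC - x * hq
    · refine ⟨2 * C, -B, by simp [hC], ?_, ?_, ?_, ?_, ?_⟩
      · linear_combination -C * h
      · linear_combination C₀ * h - C * h₀
      · linear_combination C₁ * h - C * h₁
      · linear_combination -h
      · ring
  · refine ⟨-B, 2 * A, by simp [hA], ?_, ?_, ?_, ?_, ?_⟩
    · linear_combination -A * h
    · linear_combination A₀ * h - A * h₀
    · linear_combination A₁ * h - A * h₁
    · ring
    · linear_combination -h

theorem IsFormWX.exists_eq_quadratic {α : MvPolynomial (Fin 4) ℂ} (h : IsFormWX 2 α) :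
    ∃ a b c : ℂ, α = C a * X 0 ^ 2 + C b * X 0 * X 1 + C c * X 1 ^ 2 := by
  have hmon : ∀ m : Fin 4 →₀ ℕ, ∀ a : ℂ, monomial m a =
      C a * (X 0 ^ m 0 * X 1 ^ m 1 * X 2 ^ m 2 * X 3 ^ m 3) := fun m a ↦ by
    rw [monomial_eq, Finsupp.prod_fintype _ _ (by simp), Fin.prod_univ_four]
  rw [α.as_sum]
  refine Finset.sum_induction _ (fun β : MvPolynomial (Fin 4) ℂ ↦
    ∃ a b c : ℂ, β = C a * X 0 ^ 2 + C b * X 0 * X 1 + C c * X 1 ^ 2) ?_ ⟨0, 0, 0, by simp⟩ ?_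
  · rintro _ _ ⟨a, b, c, rfl⟩ ⟨a', b', c', rfl⟩
    refine ⟨a + a', b + b', c + c', ?_⟩
    simp only [C_add]
    ring
  · intro m hm
    obtain ⟨h01, h2, h3⟩ := h m hm
    rw [hmon, h2, h3]
    obtain ⟨h0, h1⟩ | ⟨h0, h1⟩ | ⟨h0, h1⟩ :
        (m 0 = 2 ∧ m 1 = 0) ∨ (m 0 = 1 ∧ m 1 = 1) ∨ (m 0 = 0 ∧ m 1 = 2) := by lia
    · exact ⟨coeff m α, 0, 0, by simp [h0, h1]⟩
    · exact ⟨0, coeff m α, 0, by simp [h0, h1, mul_assoc]⟩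
    · exact ⟨0, 0, coeff m α, by simp [h0, h1]⟩

theorem isFormWX_linear (p q : ℂ) :
    IsFormWX 1 (C p * X 0 + C q * X 1 : MvPolynomial (Fin 4) ℂ) := by
  intro m hm
  have hm' := support_add hm
  rw [Finset.mem_union, C_mul_X_eq_monomial, C_mul_X_eq_monomial] at hm'
  rcases hm' with hm' | hm' <;>
  · rw [Finset.mem_singleton.mp (support_monomial_subset hm')]
    simp

/-- The discriminant of a smooth `(2,2)`-form has no singular zero other than the origin. -/
theorem IsSmooth22.discrim_nonsingular {α β γ : MvPolynomial (Fin 4) ℂ}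
    (hsm : IsSmooth22 (α * X 2 ^ 2 + β * X 2 * X 3 + γ * X 3 ^ 2))
    (hα : IsFormWX 2 α) (hβ : IsFormWX 2 β) (hγ : IsFormWX 2 γ)
    {w x : ℂ} (hwx : (w, x) ≠ (0, 0))
    (h : eval ![w, x, 0, 0] (β ^ 2 - 4 * α * γ) = 0)
    (hd : ∀ i, eval ![w, x, 0, 0] (pderiv i (β ^ 2 - 4 * α * γ)) = 0) : False := by
  obtain ⟨a₀, a₁, a₂, rfl⟩ := hα.exists_eq_quadratic
  obtain ⟨b₀, b₁, b₂, rfl⟩ := hβ.exists_eq_quadratic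
  obtain ⟨c₀, c₁, c₂, rfl⟩ := hγ.exists_eq_quadratic
  have h₀ := hd 0
  have h₁ := hd 1
  have four : (4 : MvPolynomial (Fin 4) ℂ) = C 4 := (map_ofNat C 4).symm
  rw [four] at h h₀ h₁
  simp [pderiv_X, Derivation.leibniz_pow] at h h₀ h₁
  obtain ⟨y, z, hyz, hF, hF₀, hF₁, hF₂, hF₃⟩ := exists_singular_of_discrim_singular hwx
    (A := a₀ * w ^ 2 + a₁ * w * x + a₂ * x ^ 2) (B := b₀ * w ^ 2 + b₁ * w * x + b₂ * x ^ 2)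
    (C := c₀ * w ^ 2 + c₁ * w * x + c₂ * x ^ 2)
    (A₀ := 2 * a₀ * w + a₁ * x) (A₁ := a₁ * w + 2 * a₂ * x)
    (B₀ := 2 * b₀ * w + b₁ * x) (B₁ := b₁ * w + 2 * b₂ * x)
    (C₀ := 2 * c₀ * w + c₁ * x) (C₁ := c₁ * w + 2 * c₂ * x)
    (by ring) (by ring) (by ring) (by linear_combination h) (by linear_combination h₀)
    (by linear_combination h₁)
  refine hsm ⟨w, x, y, z, hwx, hyz, by simpa using hF, fun i ↦ ?_⟩
  fin_cases i <;> simp [pderiv_X, Derivation.leibniz_pow]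
  · linear_combination hF₀
  · linear_combination hF₁
  · linear_combination hF₂
  · linear_combination hF₃

/-- The discriminant of quadratic forms in `w, x` is a product of linear forms in `w, x`. -/
theorem exists_discrim_eq_prod_linear {α β γ : MvPolynomial (Fin 4) ℂ}
    (hα : IsFormWX 2 α) (hβ : IsFormWX 2 β) (hγ : IsFormWX 2 γ) :
    ∃ (c : ℂ) (p q : Fin 4 → ℂ),
      β ^ 2 - 4 * α * γ = C c * ∏ i, (C (p i) * X 0 + C (q i) * X 1) := by
  obtain ⟨a₀, a₁, a₂, rfl⟩ := hα.exists_eq_quadratic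
  obtain ⟨b₀, b₁, b₂, rfl⟩ := hβ.exists_eq_quadratic
  obtain ⟨c₀, c₁, c₂, rfl⟩ := hγ.exists_eq_quadratic
  have hdeg (a b c : ℂ) : (Polynomial.C a * Polynomial.X ^ 2 + Polynomial.C b * Polynomial.X +
      Polynomial.C c).natDegree ≤ 2 := Polynomial.natDegree_quadratic_le
  have hhom (a b c : ℂ) : (Polynomial.C a * Polynomial.X ^ 2 + Polynomial.C b * Polynomial.X +
      Polynomial.C c).homogenize 2 = C a * X 0 ^ 2 + C b * X 0 * X 1 + C c * X 1 ^ 2 := by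
    simp [mul_assoc]
  have hmul (a b c a' b' c' : ℂ) := Polynomial.homogenize_mul _ _ (hdeg a b c) (hdeg a' b' c')
  simp only [hhom] at hmul
  obtain ⟨c, p, q, hprod⟩ := exists_homogenize_eq_prod_linear 4 (_ * _ - Polynomial.C 4 * (_ * _))
    ((Polynomial.natDegree_sub_le_of_le
      (Polynomial.natDegree_mul_le_of_le (hdeg b₀ b₁ b₂) (hdeg b₀ b₁ b₂))
      ((Polynomial.natDegree_C_mul_le _ _).trans
        (Polynomial.natDegree_mul_le_of_le (hdeg a₀ a₁ a₂) (hdeg c₀ c₁ c₂)))).trans (by simp))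
  refine ⟨c, p, q, ?_⟩
  rw [Polynomial.homogenize_sub, Polynomial.homogenize_C_mul, hmul b₀ b₁ b₂ b₀ b₁ b₂,
    hmul a₀ a₁ a₂ c₀ c₁ c₂] at hprod
  have hprod' := congrArg (aeval ![(X 0 : MvPolynomial (Fin 4) ℂ), X 1]) hprod
  have four : (C 4 : MvPolynomial (Fin 4) ℂ) = 4 := map_ofNat C 4
  simp [algebraMap_eq, four] at hprod' ⊢
  linear_combination hprod'

/-- For a smooth `(2,2)`-curve `F = αy² + βyz + γz²`, the discriminant
`Δ = β² − 4αγ` is nonzero and squarefree: it is a nonzero constant times a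
product of four pairwise non-proportional linear forms in `w,x`; i.e., the
projection to the first `ℙ¹` has four distinct ramification points. -/
theorem stmt8 (F α β γ : MvPolynomial (Fin 4) ℂ)
    (hFb : IsBihom 2 2 F) (hsm : IsSmooth22 F)
    (hα : IsFormWX 2 α) (hβ : IsFormWX 2 β) (hγ : IsFormWX 2 γ)
    (hF : F = α * (MvPolynomial.X 2) ^ 2
        + β * MvPolynomial.X 2 * MvPolynomial.X 3
        + γ * (MvPolynomial.X 3) ^ 2) :
    β ^ 2 - 4 * α * γ ≠ 0 ∧
    ∃ (c : ℂ) (L : Fin 4 → MvPolynomial (Fin 4) ℂ), c ≠ 0 ∧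
      (∀ i, L i ≠ 0 ∧ IsFormWX 1 (L i)) ∧
      (∀ i j, i ≠ j → ∀ d : ℂ, L i ≠ MvPolynomial.C d * L j) ∧
      β ^ 2 - 4 * α * γ = MvPolynomial.C c * L 0 * L 1 * L 2 * L 3 := by
  subst hF
  have hns {w x : ℂ} := hsm.discrim_nonsingular hα hβ hγ (w := w) (x := x)
  have hne : β ^ 2 - 4 * α * γ ≠ 0 := fun h0 ↦
    hns (w := 1) (x := 0) (by simp) (by simp only [h0, map_zero])
      (by simp only [h0, map_zero, implies_true])
  obtain ⟨c, p, q, hprod⟩ := exists_discrim_eq_prod_linear hα hβ hγ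
  have hne' := hne
  rw [hprod] at hne'
  have hL : ∀ i, (C (p i) * X 0 + C (q i) * X 1 : MvPolynomial (Fin 4) ℂ) ≠ 0 := fun i ↦
    Finset.prod_ne_zero_iff.mp (right_ne_zero_of_mul hne') i (Finset.mem_univ i)
  refine ⟨hne, c, fun i ↦ C (p i) * X 0 + C (q i) * X 1, ?_, fun i ↦ ⟨hL i, isFormWX_linear _ _⟩,
    fun i j hij d hd ↦ ?_, ?_⟩
  · rintro rfl
    simp at hne'
  · obtain ⟨M, hM⟩ : (C (p j) * X 0 + C (q j) * X 1) ^ 2 ∣ β ^ 2 - 4 * α * γ := by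
      rw [hprod, ← Finset.mul_prod_erase _ _ (Finset.mem_univ j),
        ← Finset.mul_prod_erase _ _ (Finset.mem_erase.mpr ⟨hij, Finset.mem_univ i⟩)]
      beta_reduce at hd
      rw [hd]
      exact ⟨C c * (C d * ∏ k ∈ (Finset.univ.erase j).erase i, (C (p k) * X 0 + C (q k) * X 1)),
        by ring⟩
    have hzero : eval ![-q j, p j, 0, 0]
        (C (p j) * X 0 + C (q j) * X 1 : MvPolynomial (Fin 4) ℂ) = 0 := by
      simp; ring
    refine hns (w := -q j) (x := p j) ?_ ?_ fun k ↦ ?_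
    · intro h
      obtain ⟨hq, hp⟩ := Prod.mk.inj h
      exact hL j (by simp [neg_eq_zero.mp hq, hp])
    · rw [hM, map_mul, map_pow, hzero]
      ring
    · rw [hM, Derivation.leibniz, Derivation.leibniz_pow]
      simp only [smul_eq_mul, nsmul_eq_mul, map_add, map_mul, map_pow]
      simp only [← map_mul, ← map_add, hzero]
      simp
  · rw [hprod, Fin.prod_univ_four]
    ring
end

section
/- Let F ∈ ℂ[w,x,y,z] be bihomogeneous of bidegree (2,2) and smooth, and suppose F is asymmetric: there exist three pairwise non-proportional points (y₁,z₁), (y₂,z₂), (y₃,z₃) ∈ ℂ²∖{(0,0)} such that for each i = 1,2,3 there are (wᵢ,xᵢ) ≠ (0,0) and cᵢ ≠ 0 with F(wᵢ,xᵢ,y,z) = cᵢ·(zᵢy − yᵢz)² as polynomials in y,z. Then there exist invertible 2×2 complex matrices A = (a_{ij}) and B = (b_{ij}), a constant λ ≠ 0, and s,t ∈ ℂ with s·t·(s−1)·(t−1)·(s−t) ≠ 0, such that for all w,x,y,z ∈ ℂ: F(a₁₁w + a₁₂x, a₂₁w + a₂₂x, b₁₁y + b₁₂z, b₂₁y + b₂₂z)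 = λ·(s w²z² + (1−s) wxz² − 2 wxyz + (1−t) wxy² + t x²y²). -/
open MvPolynomial in
/-- A form of bidegree `(2,2)` is given by a `3 × 3` array of coefficients. -/
lemma IsBihom.exists_coeffs {F : MvPolynomial (Fin 4) ℂ} (hF : IsBihom 2 2 F) :
    ∃ a : Fin 3 → Fin 3 → ℂ, F = ∑ i, ∑ j, C (a i j) *
      (X 0 ^ (i : ℕ) * X 1 ^ (2 - (i : ℕ)) * X 2 ^ (j : ℕ) * X 3 ^ (2 - (j : ℕ))) := by
  rw [F.as_sum]
  refine Finset.sum_induction _ (fun G : MvPolynomial (Fin 4) ℂ =>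
    ∃ a : Fin 3 → Fin 3 → ℂ, G = ∑ i, ∑ j, C (a i j) *
      (X 0 ^ (i : ℕ) * X 1 ^ (2 - (i : ℕ)) * X 2 ^ (j : ℕ) * X 3 ^ (2 - (j : ℕ)))) ?_ ?_ ?_
  · rintro _ _ ⟨a, rfl⟩ ⟨b, rfl⟩
    refine ⟨a + b, ?_⟩
    simp only [Pi.add_apply, C_add, add_mul, Finset.sum_add_distrib]
  · exact ⟨0, by simp⟩
  · intro m hm
    obtain ⟨h₁, h₂⟩ := hF m hm
    refine ⟨fun i j => if i = ⟨m 0, by omega⟩ ∧ j = ⟨m 2, by omega⟩ then coeff m F else 0, ?_⟩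
    rw [Finset.sum_eq_single ⟨m 0, by omega⟩, Finset.sum_eq_single ⟨m 2, by omega⟩]
    · rw [monomial_eq, Finsupp.prod_fintype _ _ (by simp), Fin.prod_univ_four]
      simp [show 2 - m 0 = m 1 by omega, show 2 - m 2 = m 3 by omega]
    · intro j _ hj
      simp [hj]
    · simp
    · intro i _ hi
      simp [hi]
    · simp

/-- A form of bidegree `(2,2)` is quadratic in the first pair of variables. -/
lemma IsBihom.eval_smul_add_smul_left {F : MvPolynomial (Fin 4) ℂ} (hF : IsBihom 2 2 F)
    (w x w' x' c d y z : ℂ) :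
    MvPolynomial.eval ![c * w + d * w', c * x + d * x', y, z] F =
      (c ^ 2 - c * d) * MvPolynomial.eval ![w, x, y, z] F
        + (d ^ 2 - c * d) * MvPolynomial.eval ![w', x', y, z] F
        + c * d * MvPolynomial.eval ![w + w', x + x', y, z] F := by
  obtain ⟨a, rfl⟩ := hF.exists_coeffs
  simp [Fin.sum_univ_three]
  ring

/-- A form of bidegree `(2,2)` is homogeneous in the first pair of variables. -/
lemma IsBihom.eval_smul_left {F : MvPolynomial (Fin 4) ℂ} (hF : IsBihom 2 2 F)
    (w x c y z : ℂ) :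
    MvPolynomial.eval ![c * w, c * x, y, z] F = c ^ 2 * MvPolynomial.eval ![w, x, y, z] F := by
  simpa using hF.eval_smul_add_smul_left w x 0 0 c 0 y z

/-- A linear form `u X + v Y` that vanishes on a basis of the plane is zero. -/
lemma eq_zero_and_eq_zero_of_det_ne_zero {a b c d u v : ℂ} (h : a * d - b * c ≠ 0)
    (h₁ : a * u + b * v = 0) (h₂ : c * u + d * v = 0) : u = 0 ∧ v = 0 := by
  constructor
  · refine (mul_eq_zero.1 (?_ : (a * d - b * c) * u = 0)).resolve_left h
    linear_combination d * h₁ - b * h₂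
  · refine (mul_eq_zero.1 (?_ : (a * d - b * c) * v = 0)).resolve_left h
    linear_combination a * h₂ - c * h₁

/-- On a smooth form no zero `(p, q)` has vanishing polarization in both factors. -/
lemma IsSmooth22.not_polar_eq_zero {F : MvPolynomial (Fin 4) ℂ} (hF : IsBihom 2 2 F)
    (hsm : IsSmooth22 F) {w x w' x' y z y' z' : ℂ}
    (hp : w * x' - x * w' ≠ 0) (hq : y * z' - z * y' ≠ 0)
    (h₀ : MvPolynomial.eval ![w, x, y, z] F = 0)
    (h₁ : MvPolynomial.eval ![w + w', x + x', y, z] F = MvPolynomial.eval ![w', x', y, z] F)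
    (h₂ : MvPolynomial.eval ![w, x, y + y', z + z'] F = MvPolynomial.eval ![w, x, y', z'] F) :
    False := by
  have hp₀ : (w, x) ≠ (0, 0) := by
    rintro h
    obtain ⟨rfl, rfl⟩ := Prod.mk.inj h
    simp at hp
  have hq₀ : (y, z) ≠ (0, 0) := by
    rintro h
    obtain ⟨rfl, rfl⟩ := Prod.mk.inj h
    simp at hq
  refine hsm ⟨w, x, y, z, hp₀, hq₀, h₀, ?_⟩
  obtain ⟨a, rfl⟩ := hF.exists_coeffs
  simp [Fin.sum_univ_three] at h₀ h₁ h₂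
  rw [Fin.forall_fin_succ, Fin.forall_fin_succ, Fin.forall_fin_two, ← and_assoc]
  constructor
  · apply eq_zero_and_eq_zero_of_det_ne_zero hp
    · simp [Fin.sum_univ_three, MvPolynomial.pderiv_X]
      linear_combination 2 * h₀
    · simp [Fin.sum_univ_three, MvPolynomial.pderiv_X]
      linear_combination h₁ - h₀
  · apply eq_zero_and_eq_zero_of_det_ne_zero hq
    · simp [Fin.sum_univ_three, MvPolynomial.pderiv_X]
      linear_combination 2 * h₀
    · simp [Fin.sum_univ_three, MvPolynomial.pderiv_X]
      linear_combination h₂ - h₀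

/-- Linearly dependent plane vectors, the first nonzero, are proportional. -/
lemma exists_eq_mul_of_det_eq_zero {a b c d : ℂ} (h : (a, b) ≠ (0, 0))
    (hdet : a * d - b * c = 0) : ∃ k, c = k * a ∧ d = k * b := by
  by_cases ha : a = 0
  · have hb : b ≠ 0 := fun hb => h (by rw [ha, hb])
    refine ⟨d / b, ?_, by field_simp⟩
    field_simp
    linear_combination -hdet
  · refine ⟨c / a, by field_simp, ?_⟩
    field_simp
    linear_combination hdet

/-- Of three pairwise independent plane vectors, the third is a combination of the first two
with nonzero coefficients. -/
lemma exists_nonzero_combination {a₁ b₁ a₂ b₂ a₃ b₃ : ℂ} (h₁₂ : a₁ * b₂ - b₁ * a₂ ≠ 0)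
    (h₁₃ : a₁ * b₃ - b₁ * a₃ ≠ 0) (h₂₃ : a₂ * b₃ - b₂ * a₃ ≠ 0) :
    ∃ k l : ℂ, k ≠ 0 ∧ l ≠ 0 ∧ a₃ = k * a₁ + l * a₂ ∧ b₃ = k * b₁ + l * b₂ := by
  refine ⟨-(a₂ * b₃ - b₂ * a₃) / (a₁ * b₂ - b₁ * a₂), (a₁ * b₃ - b₁ * a₃) / (a₁ * b₂ - b₁ * a₂),
    div_ne_zero (neg_ne_zero.2 h₂₃) h₁₂, div_ne_zero h₁₃ h₁₂, ?_, ?_⟩ <;>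
  · rw [div_mul_eq_mul_div, div_mul_eq_mul_div, ← add_div, eq_div_iff h₁₂]
    ring

/-- Two fibers that are squares with non-proportional double points lie over distinct points. -/
lemma IsBihom.det_ne_zero_of_square_fibers {F : MvPolynomial (Fin 4) ℂ} (hF : IsBihom 2 2 F)
    {w x w' x' y z y' z' c c' : ℂ} (hp : (w, x) ≠ (0, 0)) (hc' : c' ≠ 0)
    (hq : y * z' - z * y' ≠ 0)
    (h : ∀ u v : ℂ, MvPolynomial.eval ![w, x, u, v] F = c * (z * u - y * v) ^ 2)
    (h' : ∀ u v : ℂ, MvPolynomial.eval ![w', x', u, v] F = c' * (z' * u - y' * v) ^ 2) :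
    w * x' - x * w' ≠ 0 := by
  intro hdet
  obtain ⟨k, rfl, rfl⟩ := exists_eq_mul_of_det_eq_zero hp hdet
  have h₀ := h' y z
  rw [hF.eval_smul_left, h] at h₀
  refine mul_ne_zero hc' (pow_ne_zero 2 hq) ?_
  linear_combination -h₀

/-- An asymmetric smooth `(2,2)`-curve (one whose double points in the ramified
fibers project to at least three distinct points of the second `ℙ¹`) can be
brought, by projective linear changes of coordinates in the two `ℙ¹` factors,
into the normal form `s w²z² + (1−s) wxz² − 2 wxyz + (1−t) wxy² + t x²y²`
with `st(s−1)(t−1)(s−t) ≠ 0`. -/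
theorem stmt9 (F : MvPolynomial (Fin 4) ℂ)
    (hFb : IsBihom 2 2 F) (hsm : IsSmooth22 F)
    (yv zv : Fin 3 → ℂ)
    (hnz : ∀ i, (yv i, zv i) ≠ (0, 0))
    (hnp : ∀ i j, i ≠ j → ∀ c : ℂ, (yv j, zv j) ≠ (c * yv i, c * zv i))
    (hram : ∀ i : Fin 3, ∃ wi xi ci : ℂ, (wi, xi) ≠ (0, 0) ∧ ci ≠ 0 ∧
      ∀ y z : ℂ, MvPolynomial.eval ![wi, xi, y, z] F = ci * (zv i * y - yv i * z) ^ 2) :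
    ∃ (A B : Matrix (Fin 2) (Fin 2) ℂ) (lam s t : ℂ),
      IsUnit A.det ∧ IsUnit B.det ∧ lam ≠ 0 ∧
      s * t * (s - 1) * (t - 1) * (s - t) ≠ 0 ∧
      ∀ w x y z : ℂ,
        MvPolynomial.eval
          ![A 0 0 * w + A 0 1 * x, A 1 0 * w + A 1 1 * x,
            B 0 0 * y + B 0 1 * z, B 1 0 * y + B 1 1 * z] F
        = lam * (s * w ^ 2 * z ^ 2 + (1 - s) * w * x * z ^ 2 - 2 * w * x * y * z
            + (1 - t) * w * x * y ^ 2 + t * x ^ 2 * y ^ 2) := by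
  have hq : ∀ i j, i ≠ j → yv i * zv j - zv i * yv j ≠ 0 := by
    intro i j hij hdet
    obtain ⟨k, hy, hz⟩ := exists_eq_mul_of_det_eq_zero (hnz i) hdet
    exact hnp i j hij k (by rw [hy, hz])
  choose wv xv c hp₀ hc hfib using hram
  have hp : ∀ i j, i ≠ j → wv i * xv j - xv i * wv j ≠ 0 := fun i j hij =>
    hFb.det_ne_zero_of_square_fibers (hp₀ i) (hc j) (hq i j hij) (hfib i) (hfib j)
  have hq₀₁ := hq 0 1 (by decide)
  have hp₀₁ := hp 0 1 (by decide)
  obtain ⟨k, l, hk, hl, hw, hx⟩ :=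
    exists_nonzero_combination hp₀₁ (hp 0 2 (by decide)) (hp 1 2 (by decide))
  obtain ⟨m, n, hm, hn, hy, hz⟩ :=
    exists_nonzero_combination hq₀₁ (hq 0 2 (by decide)) (hq 1 2 (by decide))
  have hc₂ := hc 2
  obtain ⟨D, hD⟩ : ∃ D, D = yv 0 * zv 1 - zv 0 * yv 1 := ⟨_, rfl⟩
  rw [← hD] at hq₀₁
  obtain ⟨s, hs⟩ : ∃ s, s = k ^ 2 * c 0 / (c 2 * m ^ 2) := ⟨_, rfl⟩
  obtain ⟨t, ht⟩ : ∃ t, t = l ^ 2 * c 1 / (c 2 * n ^ 2) := ⟨_, rfl⟩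
  have hs₀ : s ≠ 0 := hs ▸ div_ne_zero (mul_ne_zero (pow_ne_zero 2 hk) (hc 0))
    (mul_ne_zero hc₂ (pow_ne_zero 2 hm))
  have ht₀ : t ≠ 0 := ht ▸ div_ne_zero (mul_ne_zero (pow_ne_zero 2 hl) (hc 1))
    (mul_ne_zero hc₂ (pow_ne_zero 2 hn))
  rw [eq_div_iff (mul_ne_zero hc₂ (pow_ne_zero 2 hm))] at hs
  rw [eq_div_iff (mul_ne_zero hc₂ (pow_ne_zero 2 hn))] at ht
  have hlam : c 2 * (m * n * D) ^ 2 ≠ 0 :=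
    mul_ne_zero hc₂ (pow_ne_zero 2 (mul_ne_zero (mul_ne_zero hm hn) hq₀₁))
  have hform : ∀ w x y z : ℂ, MvPolynomial.eval
      ![k * wv 0 * w + l * wv 1 * x, k * xv 0 * w + l * xv 1 * x,
        m * yv 0 * y + n * yv 1 * z, m * zv 0 * y + n * zv 1 * z] F
      = c 2 * (m * n * D) ^ 2 * (s * w ^ 2 * z ^ 2 + (1 - s) * w * x * z ^ 2 - 2 * w * x * y * z
            + (1 - t) * w * x * y ^ 2 + t * x ^ 2 * y ^ 2) := by
    intro w x y z
    have h := hFb.eval_smul_add_smul_left (k * wv 0) (k * xv 0) (l * wv 1) (l * xv 1) w x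
      (m * yv 0 * y + n * yv 1 * z) (m * zv 0 * y + n * zv 1 * z)
    rw [← hw, ← hx, hFb.eval_smul_left, hFb.eval_smul_left, hfib, hfib, hfib, hy, hz] at h
    have hvec : ∀ Y Z : ℂ, ![k * wv 0 * w + l * wv 1 * x, k * xv 0 * w + l * xv 1 * x, Y, Z]
        = ![w * (k * wv 0) + x * (l * wv 1), w * (k * xv 0) + x * (l * xv 1), Y, Z] := by
      intro Y Z
      congr 1
      · ring
      · congr 1
        ring
    rw [hvec, h, hD]
    linear_combination (-(w ^ 2 - w * x) * n ^ 2 * (yv 0 * zv 1 - zv 0 * yv 1) ^ 2 * z ^ 2) * hs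
      + (-(x ^ 2 - w * x) * m ^ 2 * (yv 0 * zv 1 - zv 0 * yv 1) ^ 2 * y ^ 2) * ht
  have hA : k * wv 0 * (l * xv 1) - k * xv 0 * (l * wv 1) ≠ 0 := by
    convert mul_ne_zero (mul_ne_zero hk hl) hp₀₁ using 1
    ring
  have hB : m * yv 0 * (n * zv 1) - m * zv 0 * (n * yv 1) ≠ 0 := by
    convert mul_ne_zero (mul_ne_zero hm hn) hq₀₁ using 1
    rw [hD]
    ring
  have hs₁ : s ≠ 1 := by
    rintro rfl
    have e₀ := hform 0 1 0 1
    have e₁ := hform 1 1 0 1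
    have e₂ := hform 1 0 0 1
    have e₃ := hform 0 1 1 1
    have e₄ := hform 0 1 1 0
    simp only [mul_one, mul_zero, add_zero, zero_add] at e₀ e₁ e₂ e₃ e₄
    refine hsm.not_polar_eq_zero hFb (w := l * wv 1) (x := l * xv 1) (w' := k * wv 0)
      (x' := k * xv 0) (y := n * yv 1) (z := n * zv 1) (y' := m * yv 0) (z' := m * zv 0)
      ?_ ?_ ?_ ?_ ?_
    · convert neg_ne_zero.2 hA using 1
      ring
    · convert neg_ne_zero.2 hB using 1
      ring
    · rw [e₀]
      ring
    · rw [add_comm (l * wv 1), add_comm (l * xv 1), e₁, e₂]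
      ring
    · rw [add_comm (n * yv 1), add_comm (n * zv 1), e₃, e₄]
      ring
  have ht₁ : t ≠ 1 := by
    rintro rfl
    have e₀ := hform 1 0 1 0
    have e₁ := hform 1 1 1 0
    have e₂ := hform 0 1 1 0
    have e₃ := hform 1 0 1 1
    have e₄ := hform 1 0 0 1
    simp only [mul_one, mul_zero, add_zero, zero_add] at e₀ e₁ e₂ e₃ e₄
    refine hsm.not_polar_eq_zero hFb hA hB ?_ ?_ ?_
    · rw [e₀]
      ring
    · rw [e₁, e₂]
      ring
    · rw [e₃, e₄]
      ring
  have hst : s ≠ t := by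
    rintro rfl
    have e₀ := hform 1 1 1 1
    have e₁ := hform 1 2 1 1
    have e₂ := hform 0 1 1 1
    have e₃ := hform 1 1 1 2
    have e₄ := hform 1 1 0 1
    simp only [mul_one, mul_zero, zero_add] at e₀ e₁ e₂ e₃ e₄
    refine hsm.not_polar_eq_zero hFb (w := k * wv 0 + l * wv 1) (x := k * xv 0 + l * xv 1)
      (w' := l * wv 1) (x' := l * xv 1) (y := m * yv 0 + n * yv 1) (z := m * zv 0 + n * zv 1)
      (y' := n * yv 1) (z' := n * zv 1) ?_ ?_ ?_ ?_ ?_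
    · convert hA using 1
      ring
    · convert hB using 1
      ring
    · rw [e₀]
      ring
    · rw [add_assoc, add_assoc, ← mul_two, ← mul_two, e₁, e₂]
      ring
    · rw [add_assoc (m * yv 0), add_assoc (m * zv 0), ← mul_two, ← mul_two, e₃, e₄]
      ring
  refine ⟨!![k * wv 0, l * wv 1; k * xv 0, l * xv 1],
    !![m * yv 0, n * yv 1; m * zv 0, n * zv 1], c 2 * (m * n * D) ^ 2, s, t, ?_, ?_, hlam, ?_, ?_⟩
  · rw [Matrix.det_fin_two_of, isUnit_iff_ne_zero]
    convert hA using 1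
    ring
  · rw [Matrix.det_fin_two_of, isUnit_iff_ne_zero]
    convert hB using 1
    ring
  · exact mul_ne_zero (mul_ne_zero (mul_ne_zero (mul_ne_zero hs₀ ht₀) (sub_ne_zero.2 hs₁))
      (sub_ne_zero.2 ht₁)) (sub_ne_zero.2 hst)
  · exact hform
end

section
/- For all s, t ∈ ℂ with s·t·(s−1)·(t−1)·(s−t) ≠ 0, there exist a symmetric 4×4 complex matrix Q and a constant μ ∈ ℂ, μ ≠ 0, such that for all w,x,y,z ∈ ℂ, writing p = (0, wy, wz, xy, xz, 0) ∈ ℂ⁶ (the Plücker vector of the line through the points (w,x,0,0) and (0,0,y,z) of ℙ³), one has pᵀ(∧²Q)p = μ·(s w²z² + (1−s) wxz² − 2 wxyz + (1−t) wxy² + t x²y²). (Every asymmetric smooth (2,2)-curve in normal form arises as the envelope of common transversals/tangents of some quadric with respect to the two lines ℓ₁ = {(w,x,0,0)} and ℓ₂ = {(0,0,y,z)}.) -/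
/-- Every asymmetric smooth `(2,2)`-curve in the normal form
`s w²z² + (1−s) wxz² − 2 wxyz + (1−t) wxy² + t x²y²` arises (up to a nonzero
scalar `μ`) as the envelope `pᵀ(∧²Q)p` of common transversals/tangents of some
quadric `Q`, where `p = (0, wy, wz, xy, xz, 0)` is the Plücker vector of the
line through `(w,x,0,0)` and `(0,0,y,z)`. -/
theorem stmt10 (s t : ℂ) (h : s * t * (s - 1) * (t - 1) * (s - t) ≠ 0) :
    ∃ (Q : Matrix (Fin 4) (Fin 4) ℂ) (μ : ℂ), Q.IsSymm ∧ μ ≠ 0 ∧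
      ∀ w x y z : ℂ,
        (∑ i, ∑ j, (![0, w*y, w*z, x*y, x*z, 0] : Fin 6 → ℂ) i * wedge2 Q i j
            * (![0, w*y, w*z, x*y, x*z, 0] : Fin 6 → ℂ) j)
          = μ * (s * w ^ 2 * z ^ 2 + (1 - s) * w * x * z ^ 2 - 2 * w * x * y * z
              + (1 - t) * w * x * y ^ 2 + t * x ^ 2 * y ^ 2) := by
  obtain ⟨σ, hσ⟩ := IsAlgClosed.exists_pow_nat_eq s (n := 2) two_pos
  obtain ⟨τ, hτ⟩ := IsAlgClosed.exists_pow_nat_eq t (n := 2) two_pos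
  -- The curve is `w x ((1 - t) y² - 2 (1 + σ τ) y z + (1 - s) z²) + (σ w z + τ x y)²`.
  refine ⟨!![0, -1 / 2, 0, σ; -1 / 2, 0, τ, 0; 0, τ, 1 - t, -(1 + σ * τ);
    σ, 0, -(1 + σ * τ), 1 - s], -1, ?_, by norm_num, fun w x y z => ?_⟩
  · ext i j
    fin_cases i <;> fin_cases j <;> rfl
  · subst hσ hτ
    simp [Fin.sum_univ_succ, wedge2, pairIdx]
    ring
end

section
/- Fix δ ∈ ℝ with δ ≠ 0. For a, b, c ∈ ℝ and r > 0, let C_{a,b,c,r}(x,z) denote the quartic polynomial 4δ²x²z² + 4δ(b−aδ)x²z + ((b−aδ)² + (1+δ²)((1+c)²−r²))x² − 4δ(b+aδ)xz² + 2((r²−c²)(1−δ²) + (1−b²) + δ²(a²−1))xz − 4(1+c)(a+bδ)x + ((b+aδ)² + (1+δ²)((1−c)²−r²))z² + 4(c−1)(a−bδ)z + 4(a²+b²−r²). If a, b, c, a′, b′, c′ ∈ ℝ, r, r′ > 0, and there exists λ ≠ 0 with C_{a,b,c,r}(x,z) = λ·C_{a′,b′,c′,r′}(x,z) for all x, z ∈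 ℝ, then (a, b, c, r) = (a′, b′, c′, r′). (The envelope curve C₁ determines the sphere S₁ uniquely.) -/
/-- The quartic envelope polynomial `C_{a,b,c,r}(x,z)` of the sphere with center
`(a,b,c)` and radius `r`, with respect to the skew lines `ℓ₁ = {(x, δx, 1)}` and
`ℓ₂ = {(z, −δz, −1)}`. -/
def envC (δ a b c r x z : ℝ) : ℝ :=
  4*δ^2*x^2*z^2 + 4*δ*(b - a*δ)*x^2*z
    + ((b - a*δ)^2 + (1 + δ^2)*((1 + c)^2 - r^2))*x^2
    - 4*δ*(b + a*δ)*x*z^2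
    + 2*((r^2 - c^2)*(1 - δ^2) + (1 - b^2) + δ^2*(a^2 - 1))*x*z
    - 4*(1 + c)*(a + b*δ)*x
    + ((b + a*δ)^2 + (1 + δ^2)*((1 - c)^2 - r^2))*z^2
    + 4*(c - 1)*(a - b*δ)*z
    + 4*(a^2 + b^2 - r^2)

/-- The envelope curve determines the sphere uniquely: if two spheres yield
proportional envelope quartics, they coincide. -/
theorem stmt14 (δ : ℝ) (hδ : δ ≠ 0)
    (a b c a' b' c' : ℝ) (r r' : ℝ) (hr : 0 < r) (hr' : 0 < r')
    (lam : ℝ) (hlam : lam ≠ 0)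
    (h : ∀ x z : ℝ, envC δ a b c r x z = lam * envC δ a' b' c' r' x z) :
    (a, b, c, r) = (a', b', c', r') := by
  have hpp := h 1 1
  have hp0 := h 1 0
  have hpm := h 1 (-1)
  have h0p := h 0 1
  have h00 := h 0 0
  have h0m := h 0 (-1)
  have hmp := h (-1) 1
  have hm0 := h (-1) 0
  have hmm := h (-1) (-1)
  simp only [envC] at hpp hp0 hpm h0p h00 h0m hmp hm0 hmm
  have hδ2 : δ ^ 2 ≠ 0 := pow_ne_zero 2 hδ
  -- comparing the coefficients of `x²z²`
  have hlam1 : lam = 1 := by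
    apply mul_left_cancel₀ hδ2
    linear_combination -(hpp - 2 * hp0 + hpm - 2 * (h0p - 2 * h00 + h0m)
      + (hmp - 2 * hm0 + hmm)) / 16
  subst hlam1
  -- comparing the coefficients of `x²z` and `xz²`
  have hsub : b - a * δ = b' - a' * δ := by
    apply mul_left_cancel₀ hδ
    linear_combination (hpp - hpm - 2 * (h0p - h0m) + (hmp - hmm)) / 16
  have hadd : b + a * δ = b' + a' * δ := by
    apply mul_left_cancel₀ hδ
    linear_combination -(hpp - hmp - 2 * (hp0 - hm0) + (hpm - hmm)) / 16
  have hb : b = b' := by linear_combination (hsub + hadd) / 2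
  have ha : a = a' := by
    apply mul_right_cancel₀ hδ
    linear_combination (hadd - hsub) / 2
  subst hb ha
  -- comparing the constant coefficients
  have hr2 : r ^ 2 = r' ^ 2 := by linear_combination -h00 / 4
  have hrr : r = r' := (pow_left_inj₀ hr.le hr'.le two_ne_zero).mp hr2
  subst hrr
  -- comparing the coefficients of `x²` and `z²`
  have hc : c = c' := by
    have hpos : 1 + δ ^ 2 ≠ 0 := by positivity
    apply mul_left_cancel₀ hpos
    linear_combination (hp0 + hm0 - h0p - h0m) / 8
  rw [hc]
end
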